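/- Let h, k be positive integers and let (a_i)_{i≥0} be a sequence with a_0 = 0 and a_i ∈ S'_p for all i ≥ 1 satisfying a_{m+k} = a_m for all m ≥ h, and let η ∈ ℚ_p be the value of the infinite Ruban continued fraction [0, a_1, a_2, …]. Then: if η is rational and h = 1, then H(η) ≤ p; if η is rational and h ≥ 2, then H(η) ≤ |q_{h−1}|_p²; and if η is a quadratic irrational, then H(η) ≤ 2·|q_{h+k−1}|_p⁴. -/

import Mathlib

open Filter Polynomial

/-- `S_p`: rationals `b` with `b·p^k ∈ ℤ` for some `k ≥ 0` and `0 ≤ b < p`. -/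
def Sp (p : ℕ) : Set ℚ :=
  {b : ℚ | (∃ k : ℕ, ∃ z : ℤ, (z : ℚ) = b * (p : ℚ) ^ k) ∧ 0 ≤ b ∧ b < (p : ℚ)}

/-- `S'_p`: elements of `S_p` with `|b|_p ≥ p`. -/
def Sp' (p : ℕ) : Set ℚ :=
  {b : ℚ | b ∈ Sp p ∧ (p : ℚ) ≤ padicNorm p b}

/-- Denominators of the convergents, with shifted index: `rubanQ a 0 = q_{-1} = 0`,
`rubanQ a 1 = q_0 = 1`, and `rubanQ a (n+1) = q_n = a_n q_{n-1} + q_{n-2}`. -/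
def rubanQ (a : ℕ → ℚ) : ℕ → ℚ
  | 0 => 0
  | 1 => 1
  | n + 2 => a (n + 1) * rubanQ a (n + 1) + rubanQ a n

/-- Numerators of the convergents, with shifted index: `rubanR a 0 = r_{-1} = 1`,
`rubanR a 1 = r_0 = a_0`, and `rubanR a (n+1) = r_n = a_n r_{n-1} + r_{n-2}`. -/
def rubanR (a : ℕ → ℚ) : ℕ → ℚ
  | 0 => 1
  | 1 => a 0
  | n + 2 => a (n + 1) * rubanR a (n + 1) + rubanR a n

/-- `α` is the value of the infinite Ruban continued fraction `[a_0, a_1, …]`, i.e. the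
limit in `ℚ_p` of the convergents `r_n / q_n`. -/
def IsRubanValue (p : ℕ) [Fact p.Prime] (a : ℕ → ℚ) (α : ℚ_[p]) : Prop :=
  Filter.Tendsto (fun n : ℕ => ((rubanR a (n + 1) / rubanQ a (n + 1) : ℚ) : ℚ_[p]))
    Filter.atTop (nhds α)

/-- A sequence is ultimately periodic if `a_{n+l} = a_n` for all `n ≥ k`,
for some `k ≥ 0`, `l ≥ 1`. -/
def UltimatelyPeriodic (a : ℕ → ℚ) : Prop :=
  ∃ k l : ℕ, 1 ≤ l ∧ ∀ n, k ≤ n → a (n + l) = a n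

/-- Membership in `ℤ[1/p]`. -/
def IsPIntegral (p : ℕ) (b : ℚ) : Prop := ∃ k : ℕ, ∃ z : ℤ, (z : ℚ) = b * (p : ℚ) ^ k

lemma padicNorm_prime_pow (p : ℕ) [hp : Fact p.Prime] (k : ℕ) :
    padicNorm p ((p : ℚ) ^ k) = ((p : ℚ) ^ k)⁻¹ := by
  induction k with
  | zero => simp
  | succ k ih =>
    rw [pow_succ, padicNorm.mul, ih, padicNorm.padicNorm_p_of_prime, mul_inv]

namespace IsPIntegral

variable {p : ℕ} {b c : ℚ}

lemma intCast (p : ℕ) (z : ℤ) : IsPIntegral p (z : ℚ) := ⟨0, z, by simp⟩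

lemma mul (hb : IsPIntegral p b) (hc : IsPIntegral p c) : IsPIntegral p (b * c) := by
  obtain ⟨k, z, hz⟩ := hb
  obtain ⟨l, w, hw⟩ := hc
  exact ⟨k + l, z * w, by push_cast; rw [hz, hw]; ring⟩

lemma add (hb : IsPIntegral p b) (hc : IsPIntegral p c) : IsPIntegral p (b + c) := by
  obtain ⟨k, z, hz⟩ := hb
  obtain ⟨l, w, hw⟩ := hc
  exact ⟨k + l, z * (p : ℤ) ^ l + w * (p : ℤ) ^ k, by push_cast; rw [hz, hw]; ring⟩

lemma sub (hb : IsPIntegral p b) (hc : IsPIntegral p c) : IsPIntegral p (b - c) := by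
  have h := hb.add ((intCast p (-1)).mul hc)
  convert h using 1
  push_cast
  ring

lemma exists_int_eq [hp : Fact p.Prime] (hb : IsPIntegral p b) (h : padicNorm p b ≤ 1) :
    ∃ z : ℤ, (z : ℚ) = b := by
  obtain ⟨k, z, hz⟩ := hb
  have hp0 : (0 : ℚ) < p := by exact_mod_cast hp.out.pos
  have hn : padicNorm p (z : ℚ) ≤ (p : ℚ) ^ (-(k : ℤ)) := by
    rw [hz, padicNorm.mul, padicNorm_prime_pow, zpow_neg, zpow_natCast]
    exact mul_le_of_le_one_left (by positivity) h
  rw [← padicNorm.dvd_iff_norm_le] at hn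
  obtain ⟨w, hw⟩ := hn
  refine ⟨w, ?_⟩
  rw [hw] at hz
  push_cast at hz
  have : ((p : ℚ) ^ k) ≠ 0 := by positivity
  apply mul_right_cancel₀ this
  rw [← hz]
  ring

end IsPIntegral

lemma padicNorm_eq_pow_of_one_le {p : ℕ} [hp : Fact p.Prime] {b : ℚ} (h : 1 ≤ padicNorm p b) :
    ∃ e : ℕ, padicNorm p b = (p : ℚ) ^ e := by
  have hb : b ≠ 0 := by
    rintro rfl
    simp at h
    linarith
  have hp1 : (1 : ℚ) < p := by exact_mod_cast hp.out.one_lt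
  rw [padicNorm.eq_zpow_of_nonzero hb] at h ⊢
  have h0 : 0 ≤ -padicValRat p b := by
    by_contra! hlt
    exact absurd h (not_le.mpr (zpow_lt_one_of_neg₀ hp1 hlt))
  obtain ⟨e, he⟩ := Int.eq_ofNat_of_zero_le h0
  exact ⟨e, by rw [he, zpow_natCast]⟩

lemma isPIntegral_padicNorm {p : ℕ} [Fact p.Prime] {b : ℚ} (h : 1 ≤ padicNorm p b) :
    IsPIntegral p (padicNorm p b) := by
  obtain ⟨e, he⟩ := padicNorm_eq_pow_of_one_le h
  rw [he]
  exact ⟨0, (p : ℤ) ^ e, by push_cast; ring⟩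

lemma padicNorm_padicNorm {p : ℕ} [hp : Fact p.Prime] {b : ℚ} (h : 1 ≤ padicNorm p b) :
    padicNorm p (padicNorm p b) = (padicNorm p b)⁻¹ := by
  obtain ⟨e, he⟩ := padicNorm_eq_pow_of_one_le h
  rw [he, padicNorm_prime_pow]

/-- Clearing denominators by a `p`-adic norm. -/
lemma IsPIntegral.exists_int_eq_padicNorm_mul {p : ℕ} [Fact p.Prime] {b c : ℚ}
    (hb : IsPIntegral p b) (hc : 1 ≤ padicNorm p c) (h : padicNorm p b ≤ padicNorm p c) :
    ∃ z : ℤ, (z : ℚ) = padicNorm p c * b := by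
  apply ((isPIntegral_padicNorm hc).mul hb).exists_int_eq
  rw [padicNorm.mul, padicNorm_padicNorm hc, inv_mul_le_iff₀ (by linarith)]
  linarith

section PartialQuotients

variable {p : ℕ} [hp : Fact p.Prime] {b : ℚ}

lemma one_lt_padicNorm_of_mem_Sp' (hb : b ∈ Sp' p) : 1 < padicNorm p b := by
  have : (1 : ℚ) < p := by exact_mod_cast hp.out.one_lt
  exact this.trans_le hb.2

lemma pos_of_mem_Sp' (hb : b ∈ Sp' p) : 0 < b := by
  refine lt_of_le_of_ne hb.1.2.1 ?_
  rintro rfl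
  have := one_lt_padicNorm_of_mem_Sp' hb
  simp at this
  linarith

lemma mul_padicNorm_le_of_mem_Sp' (hb : b ∈ Sp' p) :
    b * padicNorm p b ≤ p * padicNorm p b - 1 := by
  have h1 := one_lt_padicNorm_of_mem_Sp' hb
  obtain ⟨z, hz⟩ := IsPIntegral.exists_int_eq_padicNorm_mul hb.1.1 h1.le le_rfl
  obtain ⟨e, he⟩ := padicNorm_eq_pow_of_one_le h1.le
  have hlt : (z : ℚ) < p * padicNorm p b := by
    rw [hz]
    have := hb.1.2.2
    nlinarith
  rw [mul_comm b, ← hz]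
  rw [he] at hlt ⊢
  have hlt' : z < (p : ℤ) * (p : ℤ) ^ e := by exact_mod_cast hlt
  have : z ≤ (p : ℤ) * (p : ℤ) ^ e - 1 := by omega
  exact_mod_cast this

lemma padicNorm_eq_or_sq_le (hb : b ∈ Sp' p) :
    padicNorm p b = p ∨ (p : ℚ) ^ 2 ≤ padicNorm p b := by
  have h1 := one_lt_padicNorm_of_mem_Sp' hb
  have hp1 : (1 : ℚ) < p := by exact_mod_cast hp.out.one_lt
  obtain ⟨e, he⟩ := padicNorm_eq_pow_of_one_le h1.le
  rw [he] at h1 ⊢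
  rcases e with _ | _ | e
  · simp at h1
  · simp
  · right
    exact pow_le_pow_right₀ hp1.le (by omega)

end PartialQuotients

lemma rubanQ_add_two (a : ℕ → ℚ) (n : ℕ) :
    rubanQ a (n + 2) = a (n + 1) * rubanQ a (n + 1) + rubanQ a n := rfl

lemma rubanR_add_two (a : ℕ → ℚ) (n : ℕ) :
    rubanR a (n + 2) = a (n + 1) * rubanR a (n + 1) + rubanR a n := rfl

section Continuants

variable {p : ℕ} {a : ℕ → ℚ}

lemma rubanQ_isPIntegral (ha : ∀ i, 1 ≤ i → a i ∈ Sp' p) (n : ℕ) :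
    IsPIntegral p (rubanQ a n) := by
  induction n using Nat.twoStepInduction with
  | zero => exact IsPIntegral.intCast p 0
  | one => exact IsPIntegral.intCast p 1
  | more n h0 h1 => exact (IsPIntegral.mul (ha (n + 1) (by omega)).1.1 h1).add h0

lemma rubanR_isPIntegral (ha0 : a 0 = 0) (ha : ∀ i, 1 ≤ i → a i ∈ Sp' p) (n : ℕ) :
    IsPIntegral p (rubanR a n) := by
  induction n using Nat.twoStepInduction with
  | zero => exact IsPIntegral.intCast p 1
  | one => simpa [rubanR, ha0] using IsPIntegral.intCast p 0
  | more n h0 h1 => exact (IsPIntegral.mul (ha (n + 1) (by omega)).1.1 h1).add h0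

variable [hp : Fact p.Prime]

lemma padicNorm_rubanQ_step (ha : ∀ i, 1 ≤ i → a i ∈ Sp' p) (n : ℕ) :
    padicNorm p (rubanQ a (n + 2)) = padicNorm p (a (n + 1)) * padicNorm p (rubanQ a (n + 1)) ∧
    padicNorm p (rubanQ a n) < padicNorm p (rubanQ a (n + 1)) := by
  induction n with
  | zero =>
    simp [rubanQ]
  | succ n ih =>
    have hlt : padicNorm p (rubanQ a (n + 1)) < padicNorm p (rubanQ a (n + 2)) := by
      rw [ih.1]
      have := one_lt_padicNorm_of_mem_Sp' (ha (n + 1) (by omega))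
      have h0 : 0 < padicNorm p (rubanQ a (n + 1)) := (padicNorm.nonneg _).trans_lt ih.2
      nlinarith
    refine ⟨?_, hlt⟩
    have h1 := one_lt_padicNorm_of_mem_Sp' (ha (n + 2) (by omega))
    have h2 : padicNorm p (rubanQ a (n + 1)) <
        padicNorm p (a (n + 2) * rubanQ a (n + 2)) := by
      rw [padicNorm.mul]
      have := padicNorm.nonneg (p := p) (rubanQ a (n + 1))
      nlinarith
    rw [rubanQ_add_two, padicNorm.add_eq_max_of_ne h2.ne', max_eq_left h2.le, padicNorm.mul]

lemma padicNorm_rubanQ_add_two (ha : ∀ i, 1 ≤ i → a i ∈ Sp' p) (n : ℕ) :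
    padicNorm p (rubanQ a (n + 2)) =
      padicNorm p (a (n + 1)) * padicNorm p (rubanQ a (n + 1)) :=
  (padicNorm_rubanQ_step ha n).1

lemma padicNorm_rubanQ_strictMono (ha : ∀ i, 1 ≤ i → a i ∈ Sp' p) :
    StrictMono (fun n => padicNorm p (rubanQ a n)) :=
  strictMono_nat_of_lt_succ fun n => (padicNorm_rubanQ_step ha n).2

lemma one_le_padicNorm_rubanQ (ha : ∀ i, 1 ≤ i → a i ∈ Sp' p) {n : ℕ} (hn : 1 ≤ n) :
    1 ≤ padicNorm p (rubanQ a n) := by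
  simpa [rubanQ] using (padicNorm_rubanQ_strictMono ha).monotone hn

lemma p_mul_padicNorm_rubanQ_le (ha : ∀ i, 1 ≤ i → a i ∈ Sp' p) (n : ℕ) :
    p * padicNorm p (rubanQ a n) ≤ padicNorm p (rubanQ a (n + 1)) := by
  rcases n with _ | n
  · simp [rubanQ]
  · rw [padicNorm_rubanQ_add_two ha]
    exact mul_le_mul_of_nonneg_right (ha (n + 1) (by omega)).2 (padicNorm.nonneg _)

lemma padicNorm_rubanR_le (ha0 : a 0 = 0) (ha : ∀ i, 1 ≤ i → a i ∈ Sp' p) (n : ℕ) :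
    padicNorm p (rubanR a n) ≤ padicNorm p (rubanQ a (max n 1)) := by
  induction n using Nat.twoStepInduction with
  | zero => simp [rubanQ, rubanR]
  | one => simp [rubanQ, rubanR, ha0]
  | more n h0 h1 =>
    rw [rubanR_add_two]
    refine (padicNorm.nonarchimedean).trans (max_le ?_ ?_)
    · rw [padicNorm.mul, max_eq_left (by omega), padicNorm_rubanQ_add_two ha]
      rw [max_eq_left (by omega)] at h1
      exact mul_le_mul_of_nonneg_left h1 (padicNorm.nonneg _)
    · exact h0.trans ((padicNorm_rubanQ_strictMono ha).monotone (by omega))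

/-- The archimedean recursion bound: growth is dominated by that of the `p`-adic norms. -/
lemma recurrence_le_padicNorm (ha : ∀ i, 1 ≤ i → a i ∈ Sp' p) (n : ℕ) {s t : ℚ}
    (hs : s ≤ padicNorm p (rubanQ a (n + 1))) (ht : t ≤ padicNorm p (rubanQ a (n + 1)))
    (ht' : p * t ≤ padicNorm p (rubanQ a (n + 1))) :
    a (n + 1) * s + t ≤ padicNorm p (rubanQ a (n + 2)) := by
  rw [padicNorm_rubanQ_add_two ha]
  have hm := ha (n + 1) (by omega)
  have hp2 : (2 : ℚ) ≤ p := by exact_mod_cast hp.out.two_le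
  have h1 := one_lt_padicNorm_of_mem_Sp' hm
  have hpos := pos_of_mem_Sp' hm
  have hle := mul_padicNorm_le_of_mem_Sp' hm
  have hd : 0 ≤ padicNorm p (rubanQ a (n + 1)) := padicNorm.nonneg _
  have h3 : a (n + 1) * s ≤ a (n + 1) * padicNorm p (rubanQ a (n + 1)) :=
    mul_le_mul_of_nonneg_left hs hpos.le
  rcases padicNorm_eq_or_sq_le hm with he | he
  · rw [he] at hle ⊢
    have h4 : p * (a (n + 1) * padicNorm p (rubanQ a (n + 1)) + t) ≤
        p * (p * padicNorm p (rubanQ a (n + 1))) := by nlinarith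
    have := le_of_mul_le_mul_left h4 (by linarith)
    linarith
  · have h5 := hm.1.2.2
    have h6 : (p : ℚ) + 1 ≤ padicNorm p (a (n + 1)) := by nlinarith
    nlinarith

lemma rubanQ_nonneg (ha : ∀ i, 1 ≤ i → a i ∈ Sp' p) (n : ℕ) : 0 ≤ rubanQ a n := by
  induction n using Nat.twoStepInduction with
  | zero => simp [rubanQ]
  | one => simp [rubanQ]
  | more n h0 h1 =>
    have := pos_of_mem_Sp' (ha (n + 1) (by omega))
    rw [rubanQ_add_two]
    positivity

lemma rubanR_nonneg (ha0 : a 0 = 0) (ha : ∀ i, 1 ≤ i → a i ∈ Sp' p) (n : ℕ) :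
    0 ≤ rubanR a n := by
  induction n using Nat.twoStepInduction with
  | zero => simp [rubanR]
  | one => simp [rubanR, ha0]
  | more n h0 h1 =>
    have := pos_of_mem_Sp' (ha (n + 1) (by omega))
    rw [rubanR_add_two]
    positivity

lemma rubanQ_le_padicNorm (ha : ∀ i, 1 ≤ i → a i ∈ Sp' p) (n : ℕ) :
    rubanQ a n ≤ padicNorm p (rubanQ a n) := by
  induction n using Nat.twoStepInduction with
  | zero => simp [rubanQ]
  | one => simp [rubanQ]
  | more n h0 h1 =>
    have h2 := (padicNorm_rubanQ_strictMono ha).monotone (Nat.le_succ n)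
    have h3 := p_mul_padicNorm_rubanQ_le ha n
    refine recurrence_le_padicNorm ha n h1 (h0.trans h2) (le_trans ?_ h3)
    exact mul_le_mul_of_nonneg_left h0 (by positivity)

lemma rubanR_le_padicNorm (ha0 : a 0 = 0) (ha : ∀ i, 1 ≤ i → a i ∈ Sp' p) (n : ℕ) :
    rubanR a (n + 1) ≤ padicNorm p (rubanQ a (n + 1)) := by
  induction n using Nat.twoStepInduction with
  | zero => simp [rubanQ, rubanR, ha0]
  | one =>
    simpa [rubanR, ha0] using one_le_padicNorm_rubanQ ha (n := 2) (by norm_num)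
  | more n h0 h1 =>
    have h2 := (padicNorm_rubanQ_strictMono ha).monotone (Nat.le_succ (n + 1))
    have h3 := p_mul_padicNorm_rubanQ_le ha (n + 1)
    refine recurrence_le_padicNorm ha (n + 1) h1 (h0.trans h2) (le_trans ?_ h3)
    exact mul_le_mul_of_nonneg_left h0 (by positivity)

end Continuants

/-- The cross determinant of the `m`-th and `n`-th convergents. -/
def rubanDet (a : ℕ → ℚ) (m n : ℕ) : ℚ := rubanQ a m * rubanR a n - rubanR a m * rubanQ a n

lemma rubanDet_add_two (a : ℕ → ℚ) (m n : ℕ) :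
    rubanDet a m (n + 2) = a (n + 1) * rubanDet a m (n + 1) + rubanDet a m n := by
  simp only [rubanDet, rubanQ_add_two, rubanR_add_two]
  ring

lemma rubanDet_self (a : ℕ → ℚ) (m : ℕ) : rubanDet a m m = 0 := by
  simp only [rubanDet]
  ring

lemma rubanDet_succ (a : ℕ → ℚ) (m : ℕ) : rubanDet a m (m + 1) = (-1) ^ (m + 1) := by
  induction m with
  | zero => simp [rubanDet, rubanQ, rubanR]
  | succ m ih =>
    rw [pow_succ, ← ih]
    simp only [rubanDet, rubanQ_add_two, rubanR_add_two]
    ring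

lemma rubanDet_shift {a : ℕ → ℚ} {h k : ℕ} (hper : ∀ m, h ≤ m → a (m + k) = a m) {m : ℕ}
    (hm : h ≤ m + 1) (j : ℕ) :
    rubanDet a (m + k) (m + j + k) = (-1) ^ k * rubanDet a m (m + j) := by
  induction j using Nat.twoStepInduction with
  | zero => simp [rubanDet_self]
  | one =>
    rw [show m + 1 + k = m + k + 1 by ring, rubanDet_succ, rubanDet_succ]
    ring
  | more j h0 h1 =>
    rw [show m + (j + 2) + k = m + j + k + 2 by ring, show m + (j + 2) = m + j + 2 by ring,
      rubanDet_add_two, rubanDet_add_two, h0, show m + j + k + 1 = m + (j + 1) + k by ring, h1,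
      hper _ (by omega), show m + (j + 1) = m + j + 1 by ring]
    ring

section Determinants

variable {p : ℕ} [hp : Fact p.Prime] {a : ℕ → ℚ}

lemma rubanDet_pos (ha : ∀ i, 1 ≤ i → a i ∈ Sp' p) (m j : ℕ) :
    0 < (-1) ^ (m + 1) * rubanDet a m (m + (j + 1)) := by
  induction j using Nat.twoStepInduction with
  | zero =>
    rw [zero_add, rubanDet_succ, ← mul_pow]
    simp
  | one =>
    rw [show m + (1 + 1) = m + 2 by ring, rubanDet_add_two, rubanDet_self, rubanDet_succ,
      add_zero, mul_left_comm, ← mul_pow]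
    simpa using pos_of_mem_Sp' (ha (m + 1) (by omega))
  | more j h0 h1 =>
    rw [show m + (j + 2 + 1) = m + (j + 1) + 2 by ring, rubanDet_add_two, mul_add,
      mul_left_comm]
    have := pos_of_mem_Sp' (ha (m + (j + 1) + 1) (by omega))
    exact add_pos (mul_pos this h1) h0

lemma padicNorm_rubanDet_le (ha : ∀ i, 1 ≤ i → a i ∈ Sp' p) (m j : ℕ) :
    padicNorm p (rubanDet a m (m + j)) * padicNorm p (rubanQ a (m + 1)) ≤
      padicNorm p (rubanQ a (m + j)) := by
  induction j using Nat.twoStepInduction with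
  | zero => simpa [rubanDet_self] using padicNorm.nonneg _
  | one =>
    rw [rubanDet_succ]
    rcases neg_one_pow_eq_or ℚ (m + 1) with h | h <;> simp [h]
  | more j h0 h1 =>
    rw [show m + (j + 2) = m + j + 2 by ring, rubanDet_add_two]
    have hd := padicNorm.nonneg (p := p) (rubanQ a (m + 1))
    refine (mul_le_mul_of_nonneg_right padicNorm.nonarchimedean hd).trans ?_
    rw [max_mul_of_nonneg _ _ hd]
    refine max_le ?_ (h0.trans ((padicNorm_rubanQ_strictMono ha).monotone (by omega)))
    rw [padicNorm.mul, padicNorm_rubanQ_add_two ha, mul_assoc]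
    exact mul_le_mul_of_nonneg_left h1 (padicNorm.nonneg _)

lemma rubanQ_ne_zero (ha : ∀ i, 1 ≤ i → a i ∈ Sp' p) {n : ℕ} (hn : 1 ≤ n) :
    rubanQ a n ≠ 0 := by
  intro h
  have := one_le_padicNorm_rubanQ ha hn
  rw [h, padicNorm.zero] at this
  linarith

/-- Quality of the approximation of a rational value by its convergents. -/
lemma padicNorm_approx_le (ha : ∀ i, 1 ≤ i → a i ∈ Sp' p) {b : ℚ}
    (hb : IsRubanValue p a (b : ℚ_[p])) (n : ℕ) :
    padicNorm p (rubanQ a n * b - rubanR a n) * padicNorm p (rubanQ a (n + 1)) ≤ 1 := by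
  have hd : 0 < padicNorm p (rubanQ a (n + 1)) := by
    linarith [one_le_padicNorm_rubanQ ha (n := n + 1) (by omega)]
  rw [← le_div_iff₀ hd]
  have hlim : Tendsto (fun N : ℕ => ‖(rubanQ a n : ℚ_[p]) *
      ((rubanR a (N + 1) / rubanQ a (N + 1) : ℚ) : ℚ_[p]) - (rubanR a n : ℚ_[p])‖) atTop
      (nhds ‖(rubanQ a n : ℚ_[p]) * (b : ℚ_[p]) - (rubanR a n : ℚ_[p])‖) :=
    ((hb.const_mul _).sub_const _).norm
  have hle := le_of_tendsto (b := ((1 / padicNorm p (rubanQ a (n + 1)) : ℚ) : ℝ)) hlim ?_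
  · rw [← Rat.cast_mul, ← Rat.cast_sub, Padic.eq_padicNorm] at hle
    exact_mod_cast hle
  · filter_upwards [eventually_ge_atTop n] with N hN
    obtain ⟨j, rfl⟩ := Nat.exists_eq_add_of_le hN
    rw [← Rat.cast_mul, ← Rat.cast_sub, Padic.eq_padicNorm, Rat.cast_le]
    have hq := rubanQ_ne_zero ha (n := n + j + 1) (by omega)
    have hqd : 0 < padicNorm p (rubanQ a (n + (j + 1))) := by
      linarith [one_le_padicNorm_rubanQ ha (n := n + (j + 1)) (by omega)]
    have heq : rubanQ a n * (rubanR a (n + j + 1) / rubanQ a (n + j + 1)) - rubanR a n =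
        rubanDet a n (n + (j + 1)) / rubanQ a (n + (j + 1)) := by
      rw [← add_assoc]
      simp only [rubanDet]
      field_simp
    rw [heq, padicNorm.div, div_le_div_iff₀ hqd hd, one_mul]
    exact padicNorm_rubanDet_le ha n (j + 1)

end Determinants

/-- An integer sequence obeying a contracting two-term recursion is eventually constant, and the
coefficients of the recursion are eventually extremal. -/
lemma eventually_const_of_contracting {p : ℚ} (hp : 0 < p) {a P : ℕ → ℚ} {z : ℕ → ℤ}
    (hP : ∀ n, p ≤ P n) (ha0 : ∀ n, 0 < a n) (ha : ∀ n, a n * P n ≤ p * P n - 1)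
    (hrec : ∀ n, P (n + 1) * P n * z (n + 2) = a n * P n * z (n + 1) + z n)
    (hz : ∀ n, ¬ (z n = 0 ∧ z (n + 1) = 0)) :
    ∃ N, ∀ n, N ≤ n → a n = p - 1 / p ∧ P n = p ∧ z (n + 1) = z n := by
  have hPP : ∀ n, p * P n ≤ P (n + 1) * P n := fun n =>
    mul_le_mul_of_nonneg_right (hP _) (hp.le.trans (hP n))
  have hα : ∀ n, 0 < a n * P n := fun n => mul_pos (ha0 n) (hp.trans_le (hP n))
  have habs : ∀ n, P (n + 1) * P n * |(z (n + 2) : ℚ)| ≤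
      a n * P n * |(z (n + 1) : ℚ)| + |(z n : ℚ)| := by
    intro n
    have h0 : 0 < P (n + 1) * P n := mul_pos (hp.trans_le (hP _)) (hp.trans_le (hP _))
    rw [← abs_of_pos h0, ← abs_mul, hrec]
    refine (abs_add_le _ _).trans ?_
    rw [abs_mul, abs_of_pos (hα n)]
  set M : ℕ → ℕ := fun n => max (z n).natAbs (z (n + 1)).natAbs with hM
  have hzM : ∀ n, |(z n : ℚ)| ≤ M n ∧ |(z (n + 1) : ℚ)| ≤ M n := by
    intro n
    rw [← Int.cast_abs, ← Int.cast_abs, Int.abs_eq_natAbs, Int.abs_eq_natAbs]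
    simp only [Int.cast_natCast, Nat.cast_le, hM]
    exact ⟨le_max_left _ _, le_max_right _ _⟩
  have hanti : Antitone M := by
    refine antitone_nat_of_succ_le fun n => ?_
    have h1 : |(z (n + 2) : ℚ)| ≤ M n := by
      have h0 : 0 < P (n + 1) * P n := mul_pos (hp.trans_le (hP _)) (hp.trans_le (hP _))
      refine le_of_mul_le_mul_left ((habs n).trans ?_) h0
      have hMn : (0 : ℚ) ≤ M n := by positivity
      have h2 := mul_le_mul_of_nonneg_left (hzM n).2 (hα n).le
      have h3 := mul_le_mul_of_nonneg_right (ha n) hMn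
      have h4 := mul_le_mul_of_nonneg_right (hPP n) hMn
      linarith [(hzM n).1]
    rw [← Int.cast_abs, Int.abs_eq_natAbs, Int.cast_natCast, Nat.cast_le] at h1
    exact max_le (le_max_right _ _) h1
  obtain ⟨_, ⟨N, rfl⟩, hN⟩ := wellFounded_lt.has_min (Set.range M) ⟨M 0, 0, rfl⟩
  have hconst : ∀ n, N ≤ n → M n = M N := fun n hn =>
    le_antisymm (hanti hn) (not_lt.mp (hN _ ⟨n, rfl⟩))
  obtain ⟨W, hW⟩ : ∃ W : ℚ, W = M N := ⟨_, rfl⟩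
  have hle : ∀ n, N ≤ n → |(z n : ℚ)| ≤ W := fun n hn => by
    rw [hW, ← hconst n hn]
    exact (hzM n).1
  have hor : ∀ n, N ≤ n → |(z n : ℚ)| = W ∨ |(z (n + 1) : ℚ)| = W := fun n hn => by
    rw [hW, ← hconst n hn, ← Int.cast_abs, ← Int.cast_abs, Int.abs_eq_natAbs,
      Int.abs_eq_natAbs]
    simp only [Int.cast_natCast, Nat.cast_inj, hM]
    rcases max_choice (z n).natAbs (z (n + 1)).natAbs with h | h
    · exact Or.inl h.symm
    · exact Or.inr h.symm
  have hWpos : 0 < W := by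
    rw [hW, Nat.cast_pos]
    by_contra! h0
    have h1 := (le_max_left _ _).trans h0
    have h2 := (le_max_right _ _).trans h0
    exact hz N ⟨by omega, by omega⟩
  have hback : ∀ n, N ≤ n → |(z (n + 2) : ℚ)| = W →
      |(z (n + 1) : ℚ)| = W ∧ |(z n : ℚ)| = W := by
    intro n hn h
    have h1 := habs n
    rw [h] at h1
    have h2 := mul_le_mul_of_nonneg_right (ha n) hWpos.le
    have h3 := mul_le_mul_of_nonneg_right (hPP n) hWpos.le
    have h4 := hle n hn
    have h5 := hle (n + 1) (by omega)
    have h6 := mul_le_mul_of_nonneg_left h5 (hα n).le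
    refine ⟨le_antisymm h5 ?_, by linarith⟩
    refine le_of_mul_le_mul_left ?_ (hα n)
    linarith
  have hall : ∀ n, N ≤ n → |(z n : ℚ)| = W := by
    intro n hn
    rcases hor (n + 2) (by omega) with h | h
    · exact (hback n hn h).2
    · exact (hback n hn (hback (n + 1) (by omega) h).1).2
  have hfin : ∀ n, N ≤ n → a n * P n = p * P n - 1 ∧ P (n + 1) = p ∧ z (n + 1) = z n := by
    intro n hn
    have h0 := hall n hn
    have h1 := hall (n + 1) (by omega)
    have h2 := hall (n + 2) (by omega)
    have hPn : 0 < P n := hp.trans_le (hP n)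
    have e := habs n
    rw [h0, h1, h2] at e
    have e1 : P (n + 1) * P n ≤ a n * P n + 1 := by
      refine le_of_mul_le_mul_right ?_ hWpos
      linarith
    have e2 := ha n
    have e3 := hPP n
    have e4 : P (n + 1) * P n = p * P n := by linarith
    refine ⟨by linarith, mul_right_cancel₀ hPn.ne' e4, ?_⟩
    have e5 : |(z (n + 1) : ℚ)| = |(z n : ℚ)| := by rw [h0, h1]
    rcases abs_eq_abs.mp e5 with h | h
    · exact_mod_cast h
    · exfalso
      have hr := hrec n
      have hz' : (z n : ℚ) = -z (n + 1) := by linarith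
      have e6 : a n * P n = P (n + 1) * P n - 1 := by linarith
      rw [hz', e6] at hr
      have hr' := congrArg abs hr
      rw [show (P (n + 1) * P n - 1) * (z (n + 1) : ℚ) + -z (n + 1) =
        (P (n + 1) * P n - 2) * z (n + 1) by ring,
        abs_mul (P (n + 1) * P n), abs_mul (P (n + 1) * P n - 2), h1, h2] at hr'
      have hr2 := mul_right_cancel₀ hWpos.ne' hr'
      have := hα n
      rw [abs_of_pos (by linarith : 0 < P (n + 1) * P n)] at hr2
      rcases abs_cases (P (n + 1) * P n - 2) with ⟨h3, h4⟩ | ⟨h3, h4⟩ <;> linarith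
  refine ⟨N + 1, fun n hn => ?_⟩
  obtain ⟨m, rfl⟩ := Nat.exists_eq_add_of_le' (show 1 ≤ n by omega)
  have hPm := (hfin m (by omega)).2.1
  have h1 := hfin (m + 1) (by omega)
  refine ⟨?_, hPm, h1.2.2⟩
  have h2 := h1.1
  rw [hPm] at h2
  field_simp
  linarith

/-- If a periodic Ruban continued fraction has a rational value, the period consists of the
partial quotient `p - 1/p`; in terms of convergents, the complete quotient is `-1/p`. -/
lemma rational_tail {p : ℕ} [hp : Fact p.Prime] {a : ℕ → ℚ} (ha0 : a 0 = 0)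
    (ha : ∀ i, 1 ≤ i → a i ∈ Sp' p) {h k : ℕ} (hk : 1 ≤ k)
    (hper : ∀ m, h + 1 ≤ m → a (m + k) = a m) {b : ℚ} (hb : IsRubanValue p a (b : ℚ_[p])) :
    rubanQ a (h + 1) * b - rubanR a (h + 1) = p * (rubanQ a h * b - rubanR a h) := by
  have hp0 : (0 : ℚ) < p := by exact_mod_cast hp.out.pos
  set y : ℕ → ℚ := fun n => rubanQ a n * b - rubanR a n with hy
  have hyrec : ∀ n, y (n + 2) = a (n + 1) * y (n + 1) + y n := fun n => by
    simp only [hy, rubanQ_add_two, rubanR_add_two]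
    ring
  have hd : ∀ n, 0 < padicNorm p (rubanQ a (n + 1)) := fun n => by
    linarith [one_le_padicNorm_rubanQ ha (n := n + 1) (by omega)]
  have hb0 : (b.den : ℚ) ≠ 0 := by exact_mod_cast b.den_ne_zero
  have hinteger : ∀ n, ∃ z : ℤ, (z : ℚ) = b.den * y n / padicNorm p (rubanQ a (n + 1)) := by
    intro n
    apply IsPIntegral.exists_int_eq (p := p)
    · obtain ⟨e, he⟩ := padicNorm_eq_pow_of_one_le
        (one_le_padicNorm_rubanQ ha (n := n + 1) (by omega))
      have h1 : IsPIntegral p (((p : ℚ) ^ e)⁻¹) := ⟨e, 1, by field_simp; simp⟩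
      have h2 : (b.den : ℚ) * y n = rubanQ a n * b.num - (b.den : ℤ) * rubanR a n := by
        simp only [hy]
        rw [mul_sub, mul_left_comm, Rat.den_mul_eq_num]
        push_cast
        rfl
      rw [he, div_eq_mul_inv, h2]
      exact (((rubanQ_isPIntegral ha n).mul (IsPIntegral.intCast p _)).sub
        ((IsPIntegral.intCast p _).mul (rubanR_isPIntegral ha0 ha n))).mul h1
    · rw [padicNorm.div, padicNorm.mul,
        padicNorm_padicNorm (one_le_padicNorm_rubanQ ha (n := n + 1) (by omega)), div_inv_eq_mul,
        mul_assoc]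
      exact mul_le_one₀ (by exact_mod_cast padicNorm.of_int (p := p) (b.den : ℤ))
        (mul_nonneg (padicNorm.nonneg _) (hd n).le) (padicNorm_approx_le ha hb n)
  choose z hz using hinteger
  have hzy : ∀ n, b.den * y n = padicNorm p (rubanQ a (n + 1)) * z n := fun n => by
    rw [hz, mul_div_cancel₀ _ (hd n).ne']
  have hnot : ∀ n, ¬ (y n = 0 ∧ y (n + 1) = 0) := by
    intro n
    induction n with
    | zero =>
      simp [hy, rubanQ, rubanR]
    | succ n ih =>
      rintro ⟨h1, h2⟩
      have := hyrec n
      rw [h1, h2] at this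
      exact ih ⟨by linarith, h1⟩
  have hy0 : ∀ n, z n = 0 → y n = 0 := fun n h => by
    have := hzy n
    rw [h, Int.cast_zero, mul_zero] at this
    exact (mul_eq_zero.mp this).resolve_left hb0
  obtain ⟨N, hN⟩ := eventually_const_of_contracting (p := (p : ℚ)) hp0
    (a := fun n => a (n + 1)) (P := fun n => padicNorm p (a (n + 1))) (z := z)
    (fun n => (ha (n + 1) (by omega)).2) (fun n => pos_of_mem_Sp' (ha (n + 1) (by omega)))
    (fun n => mul_padicNorm_le_of_mem_Sp' (ha (n + 1) (by omega)))
    (fun n => by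
      have e := hyrec n
      have e1 : b.den * y (n + 2) = a (n + 1) * (b.den * y (n + 1)) + b.den * y n := by
        rw [e]
        ring
      rw [hzy, hzy, hzy, padicNorm_rubanQ_add_two ha, padicNorm_rubanQ_add_two ha] at e1
      apply mul_left_cancel₀ (hd n).ne'
      linear_combination e1)
    (fun n h => hnot n ⟨hy0 _ h.1, hy0 _ h.2⟩)
  have hperN : ∀ t m, h + 1 ≤ m → a (m + t * k) = a m := by
    intro t
    induction t with
    | zero => simp
    | succ t ih =>
      intro m hm
      rw [show m + (t + 1) * k = m + t * k + k by ring, hper _ (by omega), ih m hm]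
  have hval : ∀ m, h + 1 ≤ m → a m = p - 1 / p := by
    intro m hm
    rw [← hperN (N + 1) m hm]
    have : N + 1 ≤ (N + 1) * k := Nat.le_mul_of_pos_right _ hk
    obtain ⟨l, hl⟩ := Nat.exists_eq_add_of_le' (show 1 ≤ m + (N + 1) * k by omega)
    rw [hl]
    exact (hN l (by omega)).1
  have hend : ∀ n, N ≤ n → y (n + 1) = p * y n := by
    intro n hn
    obtain ⟨-, h2, h3⟩ := hN n hn
    have e1 := hzy (n + 1)
    rw [h3, padicNorm_rubanQ_add_two ha, h2] at e1
    apply mul_left_cancel₀ hb0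
    linear_combination e1 - p * hzy n
  have hdown : ∀ j, y (h + j + 1) = p * y (h + j) → y (h + 1) = p * y h := by
    intro j
    induction j with
    | zero => exact id
    | succ j ih =>
      intro hj
      apply ih
      have e := hyrec (h + j)
      rw [hval _ (by omega)] at e
      rw [show h + (j + 1) + 1 = h + j + 2 by ring, e, ← add_assoc] at hj
      field_simp at hj
      linarith
  exact hdown N (hend (h + N) (by omega))

/-- A primitive polynomial of minimal degree annihilating `x` has coefficients bounded by those
of any annihilating polynomial of the same degree. -/
lemma abs_coeff_le_of_minimal {K : Type*} [Field K] {x : K}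
    {f g : Polynomial ℤ} (hfx : aeval x f = 0) (hf : f.IsPrimitive)
    (hmin : ∀ g : Polynomial ℤ, g ≠ 0 → aeval x g = 0 → f.natDegree ≤ g.natDegree)
    (hg : g ≠ 0) (hgx : aeval x g = 0) (hdeg : g.natDegree ≤ f.natDegree) (i : ℕ) :
    |f.coeff i| ≤ |g.coeff i| := by
  have hn : g.natDegree = f.natDegree := le_antisymm hdeg (hmin g hg hgx)
  have hf0 : f ≠ 0 := hf.ne_zero
  have heq : C f.leadingCoeff * g = C g.leadingCoeff * f := by
    by_contra hne
    have hne' := sub_ne_zero.mpr hne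
    have h1 := hmin _ hne' (by simp [hfx, hgx])
    have h2 : (C f.leadingCoeff * g - C g.leadingCoeff * f).coeff f.natDegree = 0 := by
      simp only [coeff_sub, coeff_C_mul]
      rw [coeff_natDegree, ← hn, coeff_natDegree]
      ring
    have h3 : (C f.leadingCoeff * g - C g.leadingCoeff * f).natDegree ≤ f.natDegree :=
      (natDegree_sub_le _ _).trans
        (max_le ((natDegree_C_mul_le _ _).trans hdeg) (natDegree_C_mul_le _ _))
    rw [← le_antisymm h3 h1, coeff_natDegree, leadingCoeff_eq_zero] at h2
    exact hne' h2
  have hdvd : f.leadingCoeff ∣ g.leadingCoeff := by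
    have h1 : f.leadingCoeff ∣ (C g.leadingCoeff * f).content :=
      dvd_content_iff_C_dvd.mpr (heq ▸ dvd_mul_right _ _)
    rwa [content_C_mul, hf.content_eq_one, mul_one, dvd_normalize_iff] at h1
  obtain ⟨c, hc⟩ := hdvd
  have hl : f.leadingCoeff ≠ 0 := leadingCoeff_ne_zero.mpr hf0
  have hgi : g.coeff i = c * f.coeff i := by
    have := congrArg (fun q => q.coeff i) heq
    simp only [coeff_C_mul, hc] at this
    apply mul_left_cancel₀ hl
    linarith
  have hc0 : c ≠ 0 := by
    rintro rfl
    rw [mul_zero, leadingCoeff_eq_zero] at hc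
    exact hg hc
  rw [hgi, abs_mul]
  exact le_mul_of_one_le_left (abs_nonneg _) (Int.one_le_abs hc0)

lemma abs_coeff_le_of_quadratic_root {K : Type*} [Field K] {x : K}
    {f : Polynomial ℤ} (hfx : aeval x f = 0) (hf : f.IsPrimitive)
    (hmin : ∀ g : Polynomial ℤ, g ≠ 0 → aeval x g = 0 → f.natDegree ≤ g.natDegree)
    {u v w : ℤ} (h0 : ¬ (u = 0 ∧ v = 0 ∧ w = 0)) (hroot : (u : K) * x ^ 2 + v * x + w = 0)
    (hdeg : 2 ≤ f.natDegree ∨ 1 ≤ f.natDegree ∧ u = 0) {B : ℚ}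
    (hu : |(u : ℚ)| ≤ B) (hv : |(v : ℚ)| ≤ B) (hw : |(w : ℚ)| ≤ B) (i : ℕ) :
    (|f.coeff i| : ℚ) ≤ B := by
  set g : Polynomial ℤ := C u * X ^ 2 + C v * X + C w with hg
  have hcoeff : ∀ j, g.coeff j = if j = 2 then u else if j = 1 then v else if j = 0 then w
      else 0 := by
    intro j
    rcases j with _ | _ | _ | j <;>
      simp [hg, coeff_X, coeff_C, coeff_X_pow, -eq_intCast, -map_intCast]
  have hg0 : g ≠ 0 := by
    intro h
    apply h0
    have h2 := hcoeff 2
    have h1 := hcoeff 1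
    have h0 := hcoeff 0
    simp only [h, coeff_zero] at h0 h1 h2
    exact ⟨by simpa using h2.symm, by simpa using h1.symm, by simpa using h0.symm⟩
  have hgx : aeval x g = 0 := by simpa [hg] using hroot
  have hgdeg : g.natDegree ≤ f.natDegree := by
    rcases hdeg with h | ⟨h, rfl⟩
    · exact natDegree_quadratic_le.trans h
    · refine le_trans ?_ h
      rw [hg, C_0, zero_mul, zero_add]
      exact natDegree_linear_le
  have hle := abs_coeff_le_of_minimal hfx hf hmin hg0 hgx hgdeg i
  have hle' : (|f.coeff i| : ℚ) ≤ |(g.coeff i : ℚ)| := by exact_mod_cast hle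
  refine hle'.trans ?_
  rw [hcoeff]
  split_ifs
  · exact hu
  · exact hv
  · exact hw
  · simpa using (abs_nonneg _).trans hu

section Periodic

variable {p : ℕ} [hp : Fact p.Prime] {a : ℕ → ℚ}

lemma exists_int_eq_mul_rubanQ (ha : ∀ i, 1 ≤ i → a i ∈ Sp' p) {n j : ℕ} (hn : 1 ≤ n)
    (hj : j ≤ n) : ∃ z : ℤ, (z : ℚ) = padicNorm p (rubanQ a n) * rubanQ a j :=
  (rubanQ_isPIntegral ha j).exists_int_eq_padicNorm_mul (one_le_padicNorm_rubanQ ha hn)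
    ((padicNorm_rubanQ_strictMono ha).monotone hj)

lemma exists_int_eq_mul_rubanR (ha0 : a 0 = 0) (ha : ∀ i, 1 ≤ i → a i ∈ Sp' p) {n j : ℕ}
    (hn : 1 ≤ n) (hj : j ≤ n) :
    ∃ z : ℤ, (z : ℚ) = padicNorm p (rubanQ a n) * rubanR a j :=
  (rubanR_isPIntegral ha0 ha j).exists_int_eq_padicNorm_mul (one_le_padicNorm_rubanQ ha hn)
    ((padicNorm_rubanR_le ha0 ha j).trans
      ((padicNorm_rubanQ_strictMono ha).monotone (max_le hj hn)))

lemma rubanR_le_of_le (ha0 : a 0 = 0) (ha : ∀ i, 1 ≤ i → a i ∈ Sp' p) {n j : ℕ}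
    (hn : 1 ≤ n) (hj : j ≤ n) : rubanR a j ≤ padicNorm p (rubanQ a n) := by
  rcases j with _ | j
  · exact one_le_padicNorm_rubanQ ha hn
  · exact (rubanR_le_padicNorm ha0 ha j).trans ((padicNorm_rubanQ_strictMono ha).monotone hj)

/-- The quadratic relation satisfied by the value of a periodic continued fraction. -/
lemma periodic_quadratic_relation (ha : ∀ i, 1 ≤ i → a i ∈ Sp' p) {m k : ℕ}
    (hper : ∀ n, m + 1 ≤ n → a (n + k) = a n) {η : ℚ_[p]} (hη : IsRubanValue p a η) :
    ((rubanQ a m : ℚ_[p]) * η - rubanR a m) *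
        (rubanQ a (m + 1 + k) * η - rubanR a (m + 1 + k)) -
      (rubanQ a (m + 1) * η - rubanR a (m + 1)) * (rubanQ a (m + k) * η - rubanR a (m + k))
      = 0 := by
  have hlim := (((hη.const_mul (rubanQ a m : ℚ_[p])).sub_const (rubanR a m : ℚ_[p])).mul
    (((hη.comp (tendsto_add_atTop_nat k)).const_mul (rubanQ a (m + 1 + k) : ℚ_[p])).sub_const
      (rubanR a (m + 1 + k) : ℚ_[p]))).sub
    (((hη.const_mul (rubanQ a (m + 1) : ℚ_[p])).sub_const (rubanR a (m + 1) : ℚ_[p])).mul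
    (((hη.comp (tendsto_add_atTop_nat k)).const_mul (rubanQ a (m + k) : ℚ_[p])).sub_const
      (rubanR a (m + k) : ℚ_[p])))
  refine tendsto_nhds_unique hlim (tendsto_const_nhds.congr' ?_)
  filter_upwards [eventually_ge_atTop m] with n hn
  obtain ⟨j, rfl⟩ := Nat.exists_eq_add_of_le hn
  have e1 := rubanDet_shift hper (le_refl (m + 1)) (j + 1)
  have e2 := rubanDet_shift hper (m := m + 1) (by omega) j
  rw [show m + (j + 1) = m + j + 1 by ring] at e1
  rw [show m + 1 + j = m + j + 1 by ring] at e2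
  have hq := rubanQ_ne_zero ha (n := m + j + 1) (by omega)
  have hq' := rubanQ_ne_zero ha (n := m + j + 1 + k) (by omega)
  have key : (rubanQ a m * (rubanR a (m + j + 1) / rubanQ a (m + j + 1)) - rubanR a m) *
      (rubanQ a (m + 1 + k) * (rubanR a (m + j + 1 + k) / rubanQ a (m + j + 1 + k)) -
        rubanR a (m + 1 + k)) -
      (rubanQ a (m + 1) * (rubanR a (m + j + 1) / rubanQ a (m + j + 1)) - rubanR a (m + 1)) *
      (rubanQ a (m + k) * (rubanR a (m + j + 1 + k) / rubanQ a (m + j + 1 + k)) -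
        rubanR a (m + k)) = 0 := by
    have e3 : rubanDet a m (m + j + 1) * rubanDet a (m + 1 + k) (m + j + 1 + k) -
        rubanDet a (m + 1) (m + j + 1) * rubanDet a (m + k) (m + j + 1 + k) = 0 := by
      rw [e1, e2]
      ring
    simp only [rubanDet] at e3
    field_simp
    linear_combination e3
  simp only [Function.comp]
  rw [show m + j + k + 1 = m + j + 1 + k by ring]
  exact_mod_cast (congrArg (fun t : ℚ => (t : ℚ_[p])) key).symm

lemma rational_height_bound (ha0 : a 0 = 0) (ha : ∀ i, 1 ≤ i → a i ∈ Sp' p) {m k : ℕ}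
    (hk : 1 ≤ k) (hper : ∀ n, m + 1 ≤ n → a (n + k) = a n) {η : ℚ_[p]}
    (hη : IsRubanValue p a η) {b : ℚ} (hb : (b : ℚ_[p]) = η)
    {f : Polynomial ℤ} (hf0 : f ≠ 0) (hfη : aeval η f = 0) (hfprim : f.IsPrimitive)
    (hfmin : ∀ g : Polynomial ℤ, g ≠ 0 → aeval η g = 0 → f.natDegree ≤ g.natDegree)
    {B : ℚ} (hB : padicNorm p (rubanQ a (m + 1)) ^ 2 ≤ B)
    (hR : padicNorm p (rubanQ a (m + 1)) * (p * rubanR a m) ≤ B) (i : ℕ) :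
    (|f.coeff i| : ℚ) ≤ B := by
  subst hb
  have hd1 := one_le_padicNorm_rubanQ ha (n := m + 1) (by omega)
  have htail := rational_tail ha0 ha hk hper hη
  obtain ⟨s, hs⟩ := exists_int_eq_mul_rubanQ ha (n := m + 1) (j := m) (by omega) (by omega)
  obtain ⟨s', hs'⟩ := exists_int_eq_mul_rubanQ ha (n := m + 1) (j := m + 1) (by omega) le_rfl
  obtain ⟨t, ht⟩ :=
    exists_int_eq_mul_rubanR ha0 ha (n := m + 1) (j := m) (by omega) (by omega)
  obtain ⟨t', ht'⟩ :=
    exists_int_eq_mul_rubanR ha0 ha (n := m + 1) (j := m + 1) (by omega) le_rfl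
  have hdeg : 1 ≤ f.natDegree := by
    by_contra! h
    rw [eq_C_of_natDegree_eq_zero (by omega : f.natDegree = 0)] at hfη hf0
    simp at hfη hf0
    exact hf0 hfη
  have hdet := rubanDet_succ a m
  have hp0 : (0 : ℚ) ≤ p := by positivity
  set d := padicNorm p (rubanQ a (m + 1)) with hd
  refine abs_coeff_le_of_quadratic_root (u := 0) (v := s' - p * s) (w := p * t - t') hfη hfprim
    hfmin ?_ ?_ (Or.inr ⟨hdeg, rfl⟩) ?_ ?_ ?_ i
  · rintro ⟨-, h1, h2⟩
    have h1' : (s' : ℚ) = p * s := by exact_mod_cast sub_eq_zero.mp h1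
    have h2' : (t' : ℚ) = p * t := by exact_mod_cast (sub_eq_zero.mp h2).symm
    have h3 : d ^ 2 * rubanDet a m (m + 1) = s * t' - t * s' := by
      rw [hs, hs', ht, ht', rubanDet]
      ring
    rw [h1', h2', hdet] at h3
    have : d ^ 2 * (-1) ^ (m + 1) = 0 := by rw [h3]; ring
    have hd0 : d ≠ 0 := by linarith
    simp [hd0] at this
  · have : ((0 : ℤ) : ℚ) * b ^ 2 + ((s' - p * s : ℤ) : ℚ) * b + ((p * t - t' : ℤ) : ℚ) = 0 := by
      push_cast
      rw [hs, hs', ht, ht']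
      linear_combination d * htail
    exact_mod_cast congrArg (fun t : ℚ => (t : ℚ_[p])) this
  · have : 0 ≤ d ^ 2 := by positivity
    simpa using this.trans hB
  · push_cast
    rw [hs, hs']
    have h1 := rubanQ_nonneg ha m
    have h2 := rubanQ_nonneg ha (m + 1)
    have h3 := rubanQ_le_padicNorm ha (m + 1)
    have h4 := mul_le_mul_of_nonneg_left (rubanQ_le_padicNorm ha m) hp0
    have h5 := p_mul_padicNorm_rubanQ_le ha m
    have h6 : d * rubanQ a (m + 1) ≤ d * d := mul_le_mul_of_nonneg_left h3 (by linarith)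
    have h7 : d * (p * rubanQ a m) ≤ d * d :=
      mul_le_mul_of_nonneg_left (h4.trans h5) (by linarith)
    have h8 : 0 ≤ d * rubanQ a (m + 1) := by positivity
    have h9 : 0 ≤ d * (p * rubanQ a m) := by positivity
    rw [abs_le]
    constructor <;> linarith
  · push_cast
    rw [ht, ht']
    have h1 := rubanR_nonneg ha0 ha m
    have h2 := rubanR_nonneg ha0 ha (m + 1)
    have h3 := rubanR_le_padicNorm ha0 ha m
    have h6 : d * rubanR a (m + 1) ≤ d * d := mul_le_mul_of_nonneg_left h3 (by linarith)
    have h8 : 0 ≤ d * rubanR a (m + 1) := by positivity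
    have h9 : 0 ≤ d * (p * rubanR a m) := by positivity
    rw [abs_le]
    constructor <;> linarith

lemma quadratic_height_bound (ha0 : a 0 = 0) (ha : ∀ i, 1 ≤ i → a i ∈ Sp' p) {m k : ℕ}
    (hk : 1 ≤ k) (hper : ∀ n, m + 1 ≤ n → a (n + k) = a n) {η : ℚ_[p]}
    (hη : IsRubanValue p a η) {f : Polynomial ℤ} (hfη : aeval η f = 0) (hfprim : f.IsPrimitive)
    (hfmin : ∀ g : Polynomial ℤ, g ≠ 0 → aeval η g = 0 → f.natDegree ≤ g.natDegree)
    (hdeg : 2 ≤ f.natDegree) (i : ℕ) :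
    (|f.coeff i| : ℚ) ≤ 2 * padicNorm p (rubanQ a (m + 1 + k)) ^ 4 := by
  have hd1 := one_le_padicNorm_rubanQ ha (n := m + 1 + k) (by omega)
  have hrel := periodic_quadratic_relation ha hper hη
  have hintQ : ∀ j, j ≤ m + 1 + k → ∃ z : ℤ,
      (z : ℚ) = padicNorm p (rubanQ a (m + 1 + k)) * rubanQ a j :=
    fun j hj => exists_int_eq_mul_rubanQ ha (by omega) hj
  have hintR : ∀ j, j ≤ m + 1 + k → ∃ z : ℤ,
      (z : ℚ) = padicNorm p (rubanQ a (m + 1 + k)) * rubanR a j :=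
    fun j hj => exists_int_eq_mul_rubanR ha0 ha (by omega) hj
  have hbQ : ∀ j, j ≤ m + 1 + k → rubanQ a j ≤ padicNorm p (rubanQ a (m + 1 + k)) :=
    fun j hj => (rubanQ_le_padicNorm ha j).trans ((padicNorm_rubanQ_strictMono ha).monotone hj)
  have hbR : ∀ j, j ≤ m + 1 + k → rubanR a j ≤ padicNorm p (rubanQ a (m + 1 + k)) :=
    fun j hj => rubanR_le_of_le ha0 ha (by omega) hj
  set d := padicNorm p (rubanQ a (m + 1 + k)) with hd
  have hd0 : 0 ≤ d := by linarith
  have hbound : ∀ {z : ℤ} {c : ℚ}, (z : ℚ) = d * c → 0 ≤ c → c ≤ d →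
      0 ≤ (z : ℚ) ∧ (z : ℚ) ≤ d ^ 2 := by
    intro z c hz hc hcd
    rw [hz]
    exact ⟨by positivity, by nlinarith⟩
  obtain ⟨s₁, hs₁⟩ := hintQ m (by omega)
  obtain ⟨s₂, hs₂⟩ := hintQ (m + 1) (by omega)
  obtain ⟨s₃, hs₃⟩ := hintQ (m + k) (by omega)
  obtain ⟨s₄, hs₄⟩ := hintQ (m + 1 + k) (by omega)
  obtain ⟨t₁, ht₁⟩ := hintR m (by omega)
  obtain ⟨t₂, ht₂⟩ := hintR (m + 1) (by omega)
  obtain ⟨t₃, ht₃⟩ := hintR (m + k) (by omega)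
  obtain ⟨t₄, ht₄⟩ := hintR (m + 1 + k) (by omega)
  have bs₁ := hbound hs₁ (rubanQ_nonneg ha _) (hbQ _ (by omega))
  have bs₂ := hbound hs₂ (rubanQ_nonneg ha _) (hbQ _ (by omega))
  have bs₃ := hbound hs₃ (rubanQ_nonneg ha _) (hbQ _ (by omega))
  have bs₄ := hbound hs₄ (rubanQ_nonneg ha _) (hbQ _ (by omega))
  have bt₁ := hbound ht₁ (rubanR_nonneg ha0 ha _) (hbR _ (by omega))
  have bt₂ := hbound ht₂ (rubanR_nonneg ha0 ha _) (hbR _ (by omega))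
  have bt₃ := hbound ht₃ (rubanR_nonneg ha0 ha _) (hbR _ (by omega))
  have bt₄ := hbound ht₄ (rubanR_nonneg ha0 ha _) (hbR _ (by omega))
  have hprod : ∀ {x y : ℚ}, 0 ≤ x ∧ x ≤ d ^ 2 → 0 ≤ y ∧ y ≤ d ^ 2 →
      0 ≤ x * y ∧ x * y ≤ d ^ 4 := by
    intro x y hx hy
    refine ⟨mul_nonneg hx.1 hy.1, ?_⟩
    calc x * y ≤ d ^ 2 * d ^ 2 := mul_le_mul hx.2 hy.2 hy.1 (by positivity)
      _ = d ^ 4 := by ring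
  refine abs_coeff_le_of_quadratic_root (u := s₁ * s₄ - s₂ * s₃)
    (v := s₂ * t₃ + t₂ * s₃ - (s₁ * t₄ + t₁ * s₄)) (w := t₁ * t₄ - t₂ * t₃) hfη hfprim
    hfmin ?_ ?_ (Or.inl hdeg) ?_ ?_ ?_ i
  · rintro ⟨h1, h2, h3⟩
    have h4 : ((s₁ * t₂ - t₁ * s₂) * (s₁ * t₃ - t₁ * s₃) : ℤ) = 0 := by
      linear_combination (-t₁ ^ 2) * h1 - (s₁ * t₁) * h2 - s₁ ^ 2 * h3
    have h5 : ((s₁ * t₂ - t₁ * s₂ : ℤ) : ℚ) = d ^ 2 * rubanDet a m (m + 1) := by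
      push_cast
      rw [hs₁, hs₂, ht₁, ht₂, rubanDet]
      ring
    have h6 : ((s₁ * t₃ - t₁ * s₃ : ℤ) : ℚ) = d ^ 2 * rubanDet a m (m + k) := by
      push_cast
      rw [hs₁, hs₃, ht₁, ht₃, rubanDet]
      ring
    have hd2 : d ^ 2 ≠ 0 := by positivity
    have h7 : rubanDet a m (m + 1) ≠ 0 := right_ne_zero_of_mul (rubanDet_pos ha m 0).ne'
    obtain ⟨l, rfl⟩ := Nat.exists_eq_add_of_le' hk
    have h8 : rubanDet a m (m + (l + 1)) ≠ 0 := right_ne_zero_of_mul (rubanDet_pos ha m l).ne'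
    have h9 := congrArg (fun n : ℤ => (n : ℚ)) h4
    simp only [Int.cast_mul, h5, h6, Int.cast_zero] at h9
    simp [h7, h8, hd2] at h9
  · have hs₁' : (s₁ : ℚ_[p]) = d * rubanQ a m := by exact_mod_cast congrArg (Rat.cast) hs₁
    have hs₂' : (s₂ : ℚ_[p]) = d * rubanQ a (m + 1) := by exact_mod_cast congrArg (Rat.cast) hs₂
    have hs₃' : (s₃ : ℚ_[p]) = d * rubanQ a (m + k) := by exact_mod_cast congrArg (Rat.cast) hs₃
    have hs₄' : (s₄ : ℚ_[p]) = d * rubanQ a (m + 1 + k) := by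
      exact_mod_cast congrArg (Rat.cast) hs₄
    have ht₁' : (t₁ : ℚ_[p]) = d * rubanR a m := by exact_mod_cast congrArg (Rat.cast) ht₁
    have ht₂' : (t₂ : ℚ_[p]) = d * rubanR a (m + 1) := by exact_mod_cast congrArg (Rat.cast) ht₂
    have ht₃' : (t₃ : ℚ_[p]) = d * rubanR a (m + k) := by exact_mod_cast congrArg (Rat.cast) ht₃
    have ht₄' : (t₄ : ℚ_[p]) = d * rubanR a (m + 1 + k) := by
      exact_mod_cast congrArg (Rat.cast) ht₄
    push_cast
    rw [hs₁', hs₂', hs₃', hs₄', ht₁', ht₂', ht₃', ht₄']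
    linear_combination (d : ℚ_[p]) ^ 2 * hrel
  · have h1 := hprod bs₁ bs₄
    have h2 := hprod bs₂ bs₃
    push_cast
    rw [abs_le]
    constructor <;> linarith
  · have h1 := hprod bs₂ bt₃
    have h2 := hprod bt₂ bs₃
    have h3 := hprod bs₁ bt₄
    have h4 := hprod bt₁ bs₄
    push_cast
    rw [abs_le]
    constructor <;> linarith
  · have h1 := hprod bt₁ bt₄
    have h2 := hprod bt₂ bt₃
    push_cast
    rw [abs_le]
    constructor <;> linarith

end Periodic

/-- **Lemma 4, height bounds.** Let `η` be the value of an ultimately periodic Ruban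
continued fraction `[0, a_1, …, a_{h-1}, \overline{a_h, …, a_{h+k-1}}]`, and let `f` be
the minimal polynomial of `η` over `ℤ` (primitive, positive leading coefficient, of
minimal degree among nonzero integer polynomials vanishing at `η`), so that the
primitive height `H(η)` is `max_i |f.coeff i|`. Then `H(η) ≤ p` if `η` is rational and
`h = 1`; `H(η) ≤ |q_{h-1}|_p²` if `η` is rational and `h ≥ 2`; and
`H(η) ≤ 2 |q_{h+k-1}|_p⁴` if `η` is quadratic irrational. (Recall the index shift:
`q_m = rubanQ a (m+1)`.) -/
theorem ruban_ultimately_periodic_height_bound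
    (p : ℕ) [Fact p.Prime]
    (a : ℕ → ℚ) (ha0 : a 0 = 0) (ha : ∀ i, 1 ≤ i → a i ∈ Sp' p)
    (h k : ℕ) (hh : 1 ≤ h) (hk : 1 ≤ k)
    (hper : ∀ m, h ≤ m → a (m + k) = a m)
    (η : ℚ_[p]) (hη : IsRubanValue p a η)
    (f : Polynomial ℤ) (hf0 : f ≠ 0) (hfη : Polynomial.aeval η f = 0)
    (hfprim : f.IsPrimitive) (hflead : 0 < f.leadingCoeff)
    (hfmin : ∀ g : Polynomial ℤ, g ≠ 0 → Polynomial.aeval η g = 0 →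
      f.natDegree ≤ g.natDegree) :
    ((∃ b : ℚ, (b : ℚ_[p]) = η) → h = 1 → ∀ i, (|f.coeff i| : ℚ) ≤ (p : ℚ)) ∧
    ((∃ b : ℚ, (b : ℚ_[p]) = η) → 2 ≤ h →
      ∀ i, (|f.coeff i| : ℚ) ≤ padicNorm p (rubanQ a h) ^ 2) ∧
    ((minpoly ℚ η).natDegree = 2 →
      ∀ i, (|f.coeff i| : ℚ) ≤ 2 * padicNorm p (rubanQ a (h + k)) ^ 4) := by
  obtain ⟨m, rfl⟩ := Nat.exists_eq_add_of_le' hh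
  refine ⟨?_, ?_, ?_⟩
  · rintro ⟨b, hb⟩ h1 i
    obtain rfl : m = 0 := by omega
    have hp1 : (1 : ℚ) ≤ p := by exact_mod_cast (Fact.out : p.Prime).one_le
    exact rational_height_bound ha0 ha hk hper hη hb hf0 hfη hfprim hfmin
      (by simpa [rubanQ] using hp1) (by simp [rubanQ, rubanR]) i
  · rintro ⟨b, hb⟩ h2 i
    refine rational_height_bound ha0 ha hk hper hη hb hf0 hfη hfprim hfmin le_rfl ?_ i
    obtain ⟨l, rfl⟩ := Nat.exists_eq_add_of_le' (show 1 ≤ m by omega)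
    rw [sq]
    refine mul_le_mul_of_nonneg_left ?_ (padicNorm.nonneg _)
    exact (mul_le_mul_of_nonneg_left (rubanR_le_padicNorm ha0 ha l) (by positivity)).trans
      (p_mul_padicNorm_rubanQ_le ha (l + 1))
  · intro hdeg i
    refine quadratic_height_bound ha0 ha hk hper hη hfη hfprim hfmin ?_ i
    rw [← hdeg, ← natDegree_map_eq_of_injective (RingHom.injective_int (algebraMap ℤ ℚ)) f]
    refine natDegree_le_of_dvd (minpoly.dvd ℚ η ?_) ?_
    · rwa [aeval_map_algebraMap]
    · rwa [Ne, Polynomial.map_eq_zero_iff (RingHom.injective_int (algebraMap ℤ ℚ))]
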